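/- Let A be an n×n complex matrix and consider the map T : ℋⁿ → ℋⁿ defined by T(X) = AXA*. Then λ(|AXA*|) ≺_w λ(AA*)*λ(|X|) for all X ∈ ℋⁿ, and λ(AA*) is the least vector of T. -/

import Mathlib

open Matrix
open scoped ComplexOrder

/-- Sum of the `k` largest entries of `p` (as a supremum of sums over `k`-subsets). -/
noncomputable def sumLargest {n : ℕ} (p : Fin n → ℝ) (k : ℕ) : ℝ :=
  sSup ((fun A : Finset (Fin n) => ∑ i ∈ A, p i) '' {A : Finset (Fin n) | A.card = k})

/-- `p` is weakly majorized by `q`. -/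
def WeakMaj {n : ℕ} (p q : Fin n → ℝ) : Prop :=
  ∀ k : ℕ, 1 ≤ k → k ≤ n → sumLargest p k ≤ sumLargest q k

/-- `p` is majorized by `q`. -/
def Maj {n : ℕ} (p q : Fin n → ℝ) : Prop :=
  WeakMaj p q ∧ ∑ i, p i = ∑ i, q i

/-- `p` has nonnegative entries arranged in decreasing order. -/
def DecrNonneg {n : ℕ} (p : Fin n → ℝ) : Prop :=
  Antitone p ∧ ∀ i, 0 ≤ p i

/-- The decreasing rearrangement of a vector. -/
noncomputable def decrRearrange {n : ℕ} (p : Fin n → ℝ) : Fin n → ℝ :=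
  fun i => p (Tuple.sort p (Fin.rev i))

/-- `x` is the supremum of `S` in the weak-majorization order (w-sup). -/
def IsWSup {n : ℕ} (S : Set (Fin n → ℝ)) (x : Fin n → ℝ) : Prop :=
  DecrNonneg x ∧ (∀ s ∈ S, WeakMaj s x) ∧
    ∀ p : Fin n → ℝ, (∀ i, 0 ≤ p i) → (∀ s ∈ S, WeakMaj s p) → WeakMaj x p

/-- `x` is the infimum of `Q` in the weak-majorization order (w-inf). -/
def IsWInf {n : ℕ} (Q : Set (Fin n → ℝ)) (x : Fin n → ℝ) : Prop :=
  DecrNonneg x ∧ (∀ q ∈ Q, WeakMaj x q) ∧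
    ∀ p : Fin n → ℝ, (∀ i, 0 ≤ p i) → (∀ q ∈ Q, WeakMaj p q) → WeakMaj p x

open Classical in
/-- The vector of eigenvalues of a Hermitian matrix, in decreasing order
(junk value `0` if the matrix is not Hermitian). -/
noncomputable def specVec {n : ℕ} (X : Matrix (Fin n) (Fin n) ℂ) : Fin n → ℝ :=
  if h : X.IsHermitian then decrRearrange h.eigenvalues else 0

open Classical in
/-- `λ(|X|)`: the absolute values of the eigenvalues of a Hermitian matrix `X`,
in decreasing order. -/
noncomputable def absSpecVec {n : ℕ} (X : Matrix (Fin n) (Fin n) ℂ) : Fin n → ℝ :=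
  if h : X.IsHermitian then decrRearrange (fun i => |h.eigenvalues i|) else 0

/-- The Jordan product `X ∘ Y = (XY + YX)/2`. -/
noncomputable def jmul {n : ℕ} (X Y : Matrix (Fin n) (Fin n) ℂ) : Matrix (Fin n) (Fin n) ℂ :=
  (2 : ℂ)⁻¹ • (X * Y + Y * X)

/-- A nonzero (orthogonal) projection in `ℋⁿ`. -/
def IsProjection {n : ℕ} (P : Matrix (Fin n) (Fin n) ℂ) : Prop :=
  P.IsHermitian ∧ P * P = P ∧ P ≠ 0

/-- An involution in `ℋⁿ`: a Hermitian matrix with `ε² = I`. -/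
def IsInvolution {n : ℕ} (ε : Matrix (Fin n) (Fin n) ℂ) : Prop :=
  ε.IsHermitian ∧ ε * ε = 1

/-- A positive map: maps positive semidefinite matrices to positive semidefinite matrices. -/
def PositiveMap {n : ℕ} (T : Matrix (Fin n) (Fin n) ℂ → Matrix (Fin n) (Fin n) ℂ) : Prop :=
  ∀ X : Matrix (Fin n) (Fin n) ℂ, X.PosSemidef → (T X).PosSemidef

/-- `S` is the adjoint of `T` with respect to the trace inner product on `ℋⁿ`. -/
def IsAdjointOf {n : ℕ} (S T : Matrix (Fin n) (Fin n) ℂ → Matrix (Fin n) (Fin n) ℂ) : Prop :=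
  ∀ X Y : Matrix (Fin n) (Fin n) ℂ, X.IsHermitian → Y.IsHermitian →
    Matrix.trace (T X * Y) = Matrix.trace (X * S Y)

/-- `q` is the least vector of `T`: `λ(|T(X)|) ≺_w q * λ(|X|)` for all Hermitian `X`,
and `q ≺_w q'` for any other `q' ∈ (ℝⁿ₊)↓` with the same property. -/
def IsLeastVector {n : ℕ} (T : Matrix (Fin n) (Fin n) ℂ → Matrix (Fin n) (Fin n) ℂ)
    (q : Fin n → ℝ) : Prop :=
  DecrNonneg q ∧
  (∀ X : Matrix (Fin n) (Fin n) ℂ, X.IsHermitian →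
    WeakMaj (absSpecVec (T X)) (q * absSpecVec X)) ∧
  ∀ q' : Fin n → ℝ, DecrNonneg q' →
    (∀ X : Matrix (Fin n) (Fin n) ℂ, X.IsHermitian →
      WeakMaj (absSpecVec (T X)) (q' * absSpecVec X)) → WeakMaj q q'

section SortedSums

variable {n : ℕ}

/-- The sum of the first `k` entries of `p`. -/
noncomputable def sumFirst (k : ℕ) (p : Fin n → ℝ) : ℝ :=
  ∑ i : Fin n, if (i : ℕ) < k then p i else 0

theorem sum_mul_nonneg_of_sumFirst_nonneg (x z : Fin n → ℝ) (hx : Antitone x)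
    (hx0 : ∀ i, 0 ≤ x i) (hz : ∀ k ≤ n, 0 ≤ sumFirst k z) : 0 ≤ ∑ i, x i * z i := by
  induction n with
  | zero => simp
  | succ n ih =>
    have hprefix := ih (fun i => x i.castSucc - x (Fin.last n)) (fun i => z i.castSucc)
      (fun i j hij => sub_le_sub_right (hx (Fin.castSucc_le_castSucc_iff.2 hij)) _)
      (fun i => sub_nonneg.2 (hx (Fin.le_last _)))
      (fun k hk => by
        have := hz k (by omega)
        rw [sumFirst, Fin.sum_univ_castSucc] at this
        simpa [sumFirst, not_lt.2 hk] using this)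
    have htotal : 0 ≤ ∑ i, z i := by
      simpa only [sumFirst, Fin.is_lt, if_true] using hz (n + 1) le_rfl
    have := mul_nonneg (hx0 (Fin.last n)) htotal
    rw [Fin.sum_univ_castSucc] at this ⊢
    simp only [sub_mul, Finset.sum_sub_distrib, ← Finset.mul_sum] at hprefix
    linarith

theorem exists_decrRearrange_eq_comp (p : Fin n → ℝ) :
    ∃ σ : Equiv.Perm (Fin n), decrRearrange p = p ∘ σ :=
  ⟨Fin.revPerm.trans (Tuple.sort p), rfl⟩

theorem decrRearrange_antitone (p : Fin n → ℝ) : Antitone (decrRearrange p) :=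
  fun _ _ hij => Tuple.monotone_sort p (Fin.rev_le_rev.2 hij)

theorem decrRearrange_nonneg {p : Fin n → ℝ} (hp : ∀ i, 0 ≤ p i) (i : Fin n) :
    0 ≤ decrRearrange p i :=
  hp _

theorem sum_mul_le_sum_decrRearrange_mul (p c y : Fin n → ℝ) (hp : ∀ i, 0 ≤ p i)
    (hc : ∀ J : Finset (Fin n), ∑ i ∈ J, c i ≤ sumFirst J.card y) :
    ∑ i, p i * c i ≤ ∑ i, decrRearrange p i * y i := by
  have hanti := decrRearrange_antitone p
  have hnonneg := decrRearrange_nonneg hp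
  obtain ⟨σ, hσ⟩ := exists_decrRearrange_eq_comp p
  rw [← Equiv.sum_comp σ]
  have := sum_mul_nonneg_of_sumFirst_nonneg (decrRearrange p) (fun i => y i - c (σ i)) hanti
    hnonneg fun k hk => by
      have h := hc ((Finset.univ.filter fun i : Fin n => (i : ℕ) < k).map σ.toEmbedding)
      rw [Finset.card_map, Fin.card_filter_val_lt, min_eq_right hk, Finset.sum_map,
        Finset.sum_filter] at h
      simp only [sumFirst] at h ⊢
      rw [← sub_nonneg, ← Finset.sum_sub_distrib] at h
      convert h using 2 with i
      split_ifs <;> simp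
  simp only [mul_sub, Finset.sum_sub_distrib] at this
  rw [hσ] at this ⊢
  simp only [Function.comp_apply] at this ⊢
  linarith

theorem weakMaj_of_sum_le {p q : Fin n → ℝ}
    (h : ∀ S : Finset (Fin n), ∑ i ∈ S, p i ≤ sumFirst S.card q) : WeakMaj p q := by
  intro k _ hk
  refine csSup_le ?_ ?_
  · obtain ⟨S, -, hS⟩ := Finset.exists_subset_card_eq (s := (Finset.univ : Finset (Fin n)))
      (n := k) (by simpa using hk)
    exact ⟨_, S, hS, rfl⟩
  · rintro _ ⟨S, hS, rfl⟩
    refine (h S).trans (le_csSup (Set.toFinite _).bddAbove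
      ⟨Finset.univ.filter fun i : Fin n => (i : ℕ) < k, ?_, ?_⟩)
    · simpa [Fin.card_filter_val_lt] using hk
    · simp only [sumFirst, Finset.sum_filter]
      rw [show S.card = k from hS]

theorem sumFirst_ite_lt (j k : ℕ) (q : Fin n → ℝ) :
    sumFirst j (fun i => if (i : ℕ) < k then q i else 0) = sumFirst (min j k) q := by
  simp only [sumFirst, lt_min_iff, ite_and]

end SortedSums

section Congruence

variable {n : ℕ}

theorem mul_diagonal_mul_conjTranspose_apply_self (M : Matrix (Fin n) (Fin n) ℂ)
    (d : Fin n → ℝ) (a : Fin n) :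
    (M * diagonal (fun i => (d i : ℂ)) * Mᴴ) a a = ((∑ b, d b * ‖M a b‖ ^ 2 : ℝ) : ℂ) := by
  rw [mul_apply]
  simp only [mul_diagonal, conjTranspose_apply]
  push_cast
  refine Finset.sum_congr rfl fun b _ => ?_
  rw [← Complex.mul_conj']
  simp only [RCLike.star_def]
  ring

theorem mul_conjTranspose_apply_self (M : Matrix (Fin n) (Fin n) ℂ) (a : Fin n) :
    (M * Mᴴ) a a = ((∑ b, ‖M a b‖ ^ 2 : ℝ) : ℂ) := by
  simpa using mul_diagonal_mul_conjTranspose_apply_self M (fun _ => 1) a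

theorem sum_norm_sq_row_eq_one {R : Matrix (Fin n) (Fin n) ℂ} (hR : R * Rᴴ = 1) (a : Fin n) :
    ∑ b, ‖R a b‖ ^ 2 = 1 := by
  have := mul_conjTranspose_apply_self R a
  rw [hR, one_apply_eq] at this
  exact_mod_cast this.symm

theorem sum_norm_sq_col_eq_one {R : Matrix (Fin n) (Fin n) ℂ} (hR : Rᴴ * R = 1) (b : Fin n) :
    ∑ a, ‖R a b‖ ^ 2 = 1 := by
  simpa using sum_norm_sq_row_eq_one (R := Rᴴ) (by simpa using hR) b

theorem Matrix.IsHermitian.exists_unitary_diagonalization {X : Matrix (Fin n) (Fin n) ℂ}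
    (hX : X.IsHermitian) : ∃ U : Matrix (Fin n) (Fin n) ℂ, Uᴴ * U = 1 ∧ U * Uᴴ = 1 ∧
      X = U * diagonal (fun i => (hX.eigenvalues i : ℂ)) * Uᴴ := by
  refine ⟨hX.eigenvectorUnitary, ?_, ?_, ?_⟩
  · exact Unitary.coe_star_mul_self hX.eigenvectorUnitary
  · exact Unitary.coe_mul_star_self hX.eigenvectorUnitary
  · conv_lhs => rw [hX.spectral_theorem, Unitary.conjStarAlgAut_apply]
    rfl

/-- Ky Fan's inequality for `M * Mᴴ`: partial traces of a unitary conjugate are bounded by sums of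
the largest eigenvalues. -/
theorem sum_norm_sq_rows_le (M W : Matrix (Fin n) (Fin n) ℂ) (hW : Wᴴ * W = 1)
    (S : Finset (Fin n)) :
    ∑ a ∈ S, ∑ b, ‖(Wᴴ * M) a b‖ ^ 2 ≤ sumFirst S.card (specVec (M * Mᴴ)) := by
  have hB := isHermitian_mul_conjTranspose_self M
  obtain ⟨U, hU, hU', hBU⟩ := hB.exists_unitary_diagonalization
  have hR : (Wᴴ * U) * (Wᴴ * U)ᴴ = 1 := by
    rw [conjTranspose_mul, conjTranspose_conjTranspose, Matrix.mul_assoc,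
      ← Matrix.mul_assoc U, hU', Matrix.one_mul, hW]
  have hR' : (Wᴴ * U)ᴴ * (Wᴴ * U) = 1 := mul_eq_one_comm.1 hR
  have hrow (a : Fin n) : ∑ b, ‖(Wᴴ * M) a b‖ ^ 2
      = ∑ i, hB.eigenvalues i * ‖(Wᴴ * U) a i‖ ^ 2 := by
    have h₁ := mul_conjTranspose_apply_self (Wᴴ * M) a
    have h₂ := mul_diagonal_mul_conjTranspose_apply_self (Wᴴ * U) hB.eigenvalues a
    have h : (Wᴴ * M) * (Wᴴ * M)ᴴ
        = (Wᴴ * U) * diagonal (fun i => (hB.eigenvalues i : ℂ)) * (Wᴴ * U)ᴴ := by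
      calc (Wᴴ * M) * (Wᴴ * M)ᴴ = Wᴴ * (M * Mᴴ) * W := by
            simp only [conjTranspose_mul, conjTranspose_conjTranspose, Matrix.mul_assoc]
        _ = Wᴴ * (U * diagonal (fun i => (hB.eigenvalues i : ℂ)) * Uᴴ) * W := by rw [← hBU]
        _ = _ := by
            simp only [conjTranspose_mul, conjTranspose_conjTranspose, Matrix.mul_assoc]
    rw [h, h₂] at h₁
    exact_mod_cast h₁.symm
  simp only [hrow]
  rw [Finset.sum_comm]
  simp only [← Finset.mul_sum]
  refine (sum_mul_le_sum_decrRearrange_mul hB.eigenvalues _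
    (fun i => if (i : ℕ) < S.card then 1 else 0)
    (posSemidef_self_mul_conjTranspose M).eigenvalues_nonneg fun J => ?_).trans_eq ?_
  · have hmin : sumFirst (min J.card S.card) (fun _ : Fin n => (1 : ℝ))
        = (min J.card S.card : ℕ) := by
      have : min J.card S.card ≤ n := (min_le_left _ _).trans (by simpa using J.card_le_univ)
      rw [sumFirst, ← Finset.sum_filter, Finset.sum_const, Fin.card_filter_val_lt,
        min_eq_right this]
      simp
    rw [sumFirst_ite_lt, hmin, Nat.cast_min]
    refine le_min ?_ ?_
    · calc ∑ i ∈ J, ∑ a ∈ S, ‖(Wᴴ * U) a i‖ ^ 2 ≤ ∑ i ∈ J, ∑ a, ‖(Wᴴ * U) a i‖ ^ 2 := by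
            gcongr; exact Finset.subset_univ _
        _ = J.card := by simp only [sum_norm_sq_col_eq_one hR']; simp
    · rw [Finset.sum_comm]
      calc ∑ a ∈ S, ∑ i ∈ J, ‖(Wᴴ * U) a i‖ ^ 2 ≤ ∑ a ∈ S, ∑ i, ‖(Wᴴ * U) a i‖ ^ 2 := by
            gcongr; exact Finset.subset_univ _
        _ = S.card := by simp only [sum_norm_sq_row_eq_one hR]; simp
  · simp [specVec, hB, sumFirst]

theorem specVec_conjTranspose_mul_self (A : Matrix (Fin n) (Fin n) ℂ) :
    specVec (Aᴴ * A) = specVec (A * Aᴴ) := by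
  have h₁ := isHermitian_conjTranspose_mul_self A
  have h₂ := isHermitian_mul_conjTranspose_self A
  rw [specVec, specVec, dif_pos h₁, dif_pos h₂,
    (h₁.eigenvalues_eq_eigenvalues_iff h₂).2 (charpoly_mul_comm _ _)]

theorem absSpecVec_eq_specVec {B : Matrix (Fin n) (Fin n) ℂ} (hB : B.PosSemidef) :
    absSpecVec B = specVec B := by
  rw [absSpecVec, specVec, dif_pos hB.isHermitian, dif_pos hB.isHermitian]
  simp only [abs_of_nonneg (hB.eigenvalues_nonneg _)]

theorem decrNonneg_specVec {B : Matrix (Fin n) (Fin n) ℂ} (hB : B.PosSemidef) :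
    DecrNonneg (specVec B) := by
  rw [specVec, dif_pos hB.isHermitian]
  exact ⟨decrRearrange_antitone _, decrRearrange_nonneg hB.eigenvalues_nonneg⟩

theorem absSpecVec_one : absSpecVec (1 : Matrix (Fin n) (Fin n) ℂ) = 1 := by
  have h : (1 : Matrix (Fin n) (Fin n) ℂ).IsHermitian := isHermitian_one
  funext i
  have hone (j : Fin n) : h.eigenvalues j = 1 := by
    have : Nonempty (Fin n) := ⟨j⟩
    simpa [spectrum.one_eq] using h.eigenvalues_mem_spectrum_real j
  simp [absSpecVec, h, decrRearrange, hone]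

theorem weakMaj_absSpecVec_congruence (A : Matrix (Fin n) (Fin n) ℂ)
    {X : Matrix (Fin n) (Fin n) ℂ} (hX : X.IsHermitian) :
    WeakMaj (absSpecVec (A * X * Aᴴ)) (specVec (A * Aᴴ) * absSpecVec X) := by
  have hH : (A * X * Aᴴ).IsHermitian := isHermitian_mul_mul_conjTranspose A hX
  obtain ⟨U, hU, hU', hXU⟩ := hX.exists_unitary_diagonalization
  obtain ⟨V, hV, hV', hHV⟩ := hH.exists_unitary_diagonalization
  set G := Vᴴ * A * U with hG
  have hGrow (a : Fin n) : ∑ b, ‖G a b‖ ^ 2 = ∑ b, ‖(Vᴴ * A) a b‖ ^ 2 := by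
    have h : G * Gᴴ = (Vᴴ * A) * (Vᴴ * A)ᴴ := by
      rw [hG, conjTranspose_mul _ U, Matrix.mul_assoc, ← Matrix.mul_assoc U, hU', Matrix.one_mul]
    have h₁ := mul_conjTranspose_apply_self G a
    rw [h, mul_conjTranspose_apply_self] at h₁
    exact_mod_cast h₁.symm
  have hGcol (b : Fin n) : ∑ a, ‖G a b‖ ^ 2 = ∑ a, ‖(Uᴴ * Aᴴ) b a‖ ^ 2 := by
    have h : Gᴴ * Gᴴᴴ = (Uᴴ * Aᴴ) * (Uᴴ * Aᴴ)ᴴ := by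
      simp only [hG, conjTranspose_mul, conjTranspose_conjTranspose, Matrix.mul_assoc]
      rw [← Matrix.mul_assoc V, hV', Matrix.one_mul]
    have h₁ := mul_conjTranspose_apply_self Gᴴ b
    rw [h, mul_conjTranspose_apply_self] at h₁
    simp only [conjTranspose_apply, norm_star] at h₁
    exact_mod_cast h₁.symm
  have heig (a : Fin n) :
      hH.eigenvalues a = ∑ b, hX.eigenvalues b * ‖G a b‖ ^ 2 := by
    have h : diagonal (fun i => (hH.eigenvalues i : ℂ))
        = G * diagonal (fun i => (hX.eigenvalues i : ℂ)) * Gᴴ := by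
      calc diagonal (fun i => (hH.eigenvalues i : ℂ))
          = (Vᴴ * V) * diagonal (fun i => (hH.eigenvalues i : ℂ)) * (Vᴴ * V) := by
            rw [hV, Matrix.one_mul, Matrix.mul_one]
        _ = Vᴴ * (V * diagonal (fun i => (hH.eigenvalues i : ℂ)) * Vᴴ) * V := by
            simp only [Matrix.mul_assoc]
        _ = Vᴴ * (A * X * Aᴴ) * V := by rw [← hHV]
        _ = Vᴴ * (A * (U * diagonal (fun i => (hX.eigenvalues i : ℂ)) * Uᴴ) * Aᴴ) * V := by
            rw [← hXU]
        _ = _ := by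
            simp only [hG, conjTranspose_mul, conjTranspose_conjTranspose, Matrix.mul_assoc]
    have h₁ := mul_diagonal_mul_conjTranspose_apply_self G hX.eigenvalues a
    rw [← h, diagonal_apply_eq] at h₁
    exact_mod_cast h₁
  have hsum (S : Finset (Fin n)) : ∑ a ∈ S, |hH.eigenvalues a|
      ≤ sumFirst S.card (specVec (A * Aᴴ) * absSpecVec X) := by
    calc ∑ a ∈ S, |hH.eigenvalues a|
        ≤ ∑ a ∈ S, ∑ b, |hX.eigenvalues b| * ‖G a b‖ ^ 2 := by
          refine Finset.sum_le_sum fun a _ => ?_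
          rw [heig]
          refine (Finset.abs_sum_le_sum_abs _ _).trans_eq (Finset.sum_congr rfl fun b _ => ?_)
          rw [abs_mul, abs_of_nonneg (sq_nonneg ‖G a b‖)]
      _ = ∑ b, |hX.eigenvalues b| * ∑ a ∈ S, ‖G a b‖ ^ 2 := by
          rw [Finset.sum_comm]
          simp only [Finset.mul_sum]
      _ ≤ ∑ i, decrRearrange (fun i => |hX.eigenvalues i|) i *
            (if (i : ℕ) < S.card then specVec (A * Aᴴ) i else 0) := by
          refine sum_mul_le_sum_decrRearrange_mul (fun i => |hX.eigenvalues i|) _ _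
            (fun _ => abs_nonneg _) fun J => ?_
          rw [sumFirst_ite_lt]
          rcases min_choice J.card S.card with h | h <;> rw [h]
          · calc ∑ b ∈ J, ∑ a ∈ S, ‖G a b‖ ^ 2 ≤ ∑ b ∈ J, ∑ a, ‖G a b‖ ^ 2 := by
                  gcongr; exact Finset.subset_univ _
              _ = ∑ b ∈ J, ∑ a, ‖(Uᴴ * Aᴴ) b a‖ ^ 2 := by simp only [hGcol]
              _ ≤ sumFirst J.card (specVec (Aᴴ * Aᴴᴴ)) := sum_norm_sq_rows_le Aᴴ U hU J
              _ = _ := by rw [conjTranspose_conjTranspose, specVec_conjTranspose_mul_self]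
          · rw [Finset.sum_comm]
            calc ∑ a ∈ S, ∑ b ∈ J, ‖G a b‖ ^ 2 ≤ ∑ a ∈ S, ∑ b, ‖G a b‖ ^ 2 := by
                  gcongr; exact Finset.subset_univ _
              _ = ∑ a ∈ S, ∑ b, ‖(Vᴴ * A) a b‖ ^ 2 := by simp only [hGrow]
              _ ≤ _ := sum_norm_sq_rows_le A V hV S
      _ = _ := by
          simp only [sumFirst, absSpecVec, dif_pos hX, Pi.mul_apply, ite_mul, zero_mul,
            mul_comm (decrRearrange _ _)]
  refine weakMaj_of_sum_le fun S => ?_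
  rw [show absSpecVec (A * X * Aᴴ) = decrRearrange (fun i => |hH.eigenvalues i|) by
    rw [absSpecVec, dif_pos hH]]
  obtain ⟨σ, hσ⟩ := exists_decrRearrange_eq_comp fun i => |hH.eigenvalues i|
  rw [hσ]
  simpa using hsum (S.map σ.toEmbedding)

end Congruence

theorem congruence_least_vector (n : ℕ) (A : Matrix (Fin n) (Fin n) ℂ) :
    (∀ X : Matrix (Fin n) (Fin n) ℂ, X.IsHermitian →
      WeakMaj (absSpecVec (A * X * Aᴴ)) (specVec (A * Aᴴ) * absSpecVec X)) ∧
    IsLeastVector (fun X => A * X * Aᴴ) (specVec (A * Aᴴ)) := by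
  have hpos := posSemidef_self_mul_conjTranspose A
  have hmaj (X : Matrix (Fin n) (Fin n) ℂ) (hX : X.IsHermitian) :=
    weakMaj_absSpecVec_congruence A hX
  refine ⟨hmaj, decrNonneg_specVec hpos, hmaj, fun q _ hq => ?_⟩
  simpa [absSpecVec_one, absSpecVec_eq_specVec hpos] using hq 1 isHermitian_one
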